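/- arXiv:1706.09616 — 4 statements merged into one kernel-verified Lean document; each statement's English description precedes it below -/
import Mathlib

section
/- Let L₁, L be real numbers with 0 < L₁ ≤ L/2, set α := L₁/L and suppose α is irrational; define ξ_n = 2|αn − ⌊αn + 1/2⌋|. Let (ω_n)_{n≥1} be a sequence of negative reals such that for every n ≥ 1 there exists k ∈ (1/√2, 1) with S(k) = L·√(−ω_n)/n and φ(k) = ξ_n. Then there exist infinitely many indices n with 0 ≤ √(−ω_n) ≤ (1/L)·K(1/√2)². -/
open Real Filter Set

/-- Complete elliptic integral of the first kind. -/
noncomputable def Kell (k : ℝ) : ℝ :=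
  ∫ t in (0:ℝ)..1, 1 / Real.sqrt ((1 - t^2) * (1 - k^2 * t^2))

/-- S(k) = 4√(2k²−1)·K(k). -/
noncomputable def Sfun (k : ℝ) : ℝ := 4 * Real.sqrt (2 * k^2 - 1) * Kell k

/-- H(k), the numerator in the definition of φ. -/
noncomputable def Hfun (k : ℝ) : ℝ :=
  ∫ t in Real.sqrt ((2 * k^2 - 1) / k^2)..1,
    1 / Real.sqrt ((1 - t^2) * (1 - k^2 * (1 - t^2)))

/-- φ(k) = H(k)/K(k). -/
noncomputable def phiFun (k : ℝ) : ℝ := Hfun k / Kell k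

/-- ξ_n = 2|αn − ⌊αn + 1/2⌋|. -/
noncomputable def xiSeq (α : ℝ) (n : ℕ) : ℝ :=
  2 * |α * n - (⌊α * n + 1/2⌋ : ℝ)|

theorem exists_consecutive_approximants {α : ℝ} (hirr : Irrational α) (h0 : 0 < α)
    (h1 : α < 1 / 2) (n : ℕ) :
    ∃ q₁ q₂ p₁ p₂ σ : ℤ, (σ = 1 ∨ σ = -1) ∧ 1 ≤ q₁ ∧ (n : ℤ) ≤ q₁ ∧ q₁ < q₂ ∧
      0 < -(σ * (q₂ * α - p₂)) ∧ -(σ * (q₂ * α - p₂)) < σ * (q₁ * α - p₁) ∧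
      σ * (q₁ * p₂ - q₂ * p₁) = 1 := by
  induction n with
  | zero =>
    have ha2 : (2 : ℤ) ≤ ⌊1 / α⌋ := by
      rw [Int.le_floor, le_div_iff₀ h0]; push_cast; linarith
    have hle : (⌊1 / α⌋ : ℝ) ≤ 1 / α := Int.floor_le _
    have hlt : 1 / α < (⌊1 / α⌋ : ℝ) + 1 := Int.lt_floor_add_one _
    rw [le_div_iff₀ h0] at hle
    rw [div_lt_iff₀ h0] at hlt
    have hne : (⌊1 / α⌋ : ℝ) * α ≠ 1 := by
      have := hirr.intCast_mul (m := ⌊1 / α⌋) (by omega)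
      exact fun h => this.ne_one h
    refine ⟨1, ⌊1 / α⌋, 0, 1, 1, Or.inl rfl, le_rfl, by simp, by omega, ?_, ?_, by simp⟩
    · have := lt_of_le_of_ne hle hne
      push_cast; linarith
    · push_cast; linarith
  | succ n ih =>
    obtain ⟨q₁, q₂, p₁, p₂, σ, hσ, hq, hn, hlt, hd2, hd1, hdet⟩ := ih
    set d₂ : ℝ := -(σ * (q₂ * α - p₂)) with hd₂
    set d₁ : ℝ := σ * (q₁ * α - p₁) with hd₁
    have ha1 : (1 : ℤ) ≤ ⌊d₁ / d₂⌋ := by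
      rw [Int.le_floor, le_div_iff₀ hd2]; push_cast; linarith
    have hle : (⌊d₁ / d₂⌋ : ℝ) ≤ d₁ / d₂ := Int.floor_le _
    have hlt' : d₁ / d₂ < (⌊d₁ / d₂⌋ : ℝ) + 1 := Int.lt_floor_add_one _
    rw [le_div_iff₀ hd2] at hle
    rw [div_lt_iff₀ hd2] at hlt'
    set a := ⌊d₁ / d₂⌋
    have hq' : q₂ < q₁ + a * q₂ := by nlinarith
    have heq : d₁ - a * d₂ = -((-σ : ℤ) * ((q₁ + a * q₂ : ℤ) * α - (p₁ + a * p₂ : ℤ))) := by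
      rw [hd₁, hd₂]; push_cast; ring
    have hne : d₁ - a * d₂ ≠ 0 := by
      rw [heq]
      have h1 := (hirr.intCast_mul (m := q₁ + a * q₂) (by omega)).sub_intCast (p₁ + a * p₂)
      have h2 := h1.intCast_mul (m := -σ) (by omega)
      exact neg_ne_zero.2 h2.ne_zero
    refine ⟨q₂, q₁ + a * q₂, p₂, p₁ + a * p₂, -σ, by omega, by omega, by push_cast; omega, hq',
      ?_, ?_, ?_⟩
    · rw [← heq]
      exact lt_of_le_of_ne (by linarith) hne.symm
    · rw [← heq]
      have : (-σ : ℤ) * (q₂ * α - p₂) = d₂ := by rw [hd₂]; push_cast; ring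
      rw [this]; linarith
    · linear_combination hdet

theorem Irrational.exists_pos_le_abs_mul_sub {α : ℝ} (hirr : Irrational α) (N : ℕ) :
    ∃ η > (0 : ℝ), ∀ q p : ℤ, 1 ≤ q → q ≤ N → η ≤ |q * α - p| := by
  induction N with
  | zero => exact ⟨1, one_pos, fun q p h1 h2 => by push_cast at h2; omega⟩
  | succ N ih =>
    obtain ⟨η, hη, h⟩ := ih
    have hpos : 0 < |((N + 1 : ℤ) : ℝ) * α - round (((N + 1 : ℤ) : ℝ) * α)| :=
      abs_pos.2 ((hirr.intCast_mul (m := (N + 1 : ℤ)) (by omega)).sub_intCast _).ne_zero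
    refine ⟨min η _, lt_min hη hpos, fun q p h1 h2 => ?_⟩
    rcases le_or_gt q N with hq | hq
    · exact (min_le_left _ _).trans (h q p h1 hq)
    · obtain rfl : q = (N + 1 : ℤ) := by push_cast at h2; omega
      exact (min_le_right _ _).trans (round_le _ _)

/-- Two consecutive approximants with both denominators odd: their sum or their difference has
a small product of denominator and error. -/
theorem product_bound_of_basis {C N q₁ q₂ d₁ d₂ : ℝ} (hC : 0 ≤ C) (hN : 4 * C + 4 ≤ N)
    (hq₁ : N ≤ q₁) (hq : q₁ < q₂) (hr : N ≤ q₂ - q₁)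
    (hd₂ : 0 < d₂) (hd : d₂ < d₁) (hdet : q₁ * d₂ + q₂ * d₁ = 1) :
    (q₁ + q₂) * |d₁ - d₂| ≤ 1 - C / (q₁ + q₂) ^ 2 ∨
      (q₂ - q₁) * |d₁ + d₂| ≤ 1 - C / (q₂ - q₁) ^ 2 := by
  have hq₁0 : 0 < q₁ := by linarith
  have hq₂0 : 0 < q₂ := by linarith
  rw [abs_of_pos (by linarith : 0 < d₁ - d₂), abs_of_pos (by linarith : 0 < d₁ + d₂)]
  have hd₁q : 1 ≤ 2 * (q₂ * d₁) := by
    nlinarith [mul_lt_mul'' hq hd hq₁0.le hd₂.le]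
  have hNsq : 16 * C ≤ N ^ 2 := by nlinarith
  rcases lt_or_ge (q₁ * d₁) (q₂ * d₂) with hs | hs
  · left
    have key : C / (q₁ + q₂) ^ 2 ≤ q₂ * d₂ - q₁ * d₁ + 2 * (q₁ * d₂) := by
      rw [div_le_iff₀ (by positivity)]
      have h1 : q₁ ≤ 2 * (q₂ * q₂ * d₂) := by nlinarith
      have h2 : q₁ * q₁ ≤ 2 * (q₁ * d₂) * (q₂ * q₂) := by nlinarith
      have h3 : 2 * (q₁ * d₂) * (q₂ * q₂) ≤ 2 * (q₁ * d₂) * (q₁ + q₂) ^ 2 := by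
        apply mul_le_mul_of_nonneg_left _ (by positivity); nlinarith
      have h4 : 0 ≤ (q₂ * d₂ - q₁ * d₁) * (q₁ + q₂) ^ 2 :=
        mul_nonneg (by linarith) (by positivity)
      nlinarith
    nlinarith
  · right
    have hr0 : 0 < q₂ - q₁ := by linarith
    have key : C / (q₂ - q₁) ^ 2 ≤ q₁ * d₁ - q₂ * d₂ + 2 * (q₁ * d₂) := by
      rw [div_le_iff₀ (by positivity)]
      have hrN : N ^ 2 ≤ (q₂ - q₁) ^ 2 := by nlinarith
      rcases lt_or_ge q₂ (2 * q₁) with hc | hc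
      · have h1 : 1 / 4 ≤ q₁ * d₁ - q₂ * d₂ + 2 * (q₁ * d₂) := by
          nlinarith [mul_pos hd₂ (by linarith : 0 < 2 * q₁ - q₂),
            mul_pos (hd₂.trans hd) (by linarith : 0 < 2 * q₁ - q₂)]
        nlinarith
      · have h2 : q₂ ^ 2 ≤ 4 * (q₂ - q₁) ^ 2 := by nlinarith
        have h3 : q₁ ^ 2 ≤ 4 * ((q₁ * d₁ - q₂ * d₂ + 2 * (q₁ * d₂)) * q₂ ^ 2) := by
          have hs' : 0 ≤ q₁ * d₁ - q₂ * d₂ := by linarith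
          have h4 : 2 * q₁ * (q₁ * d₁ - q₂ * d₂) ≤ q₂ * (q₁ * d₁ - q₂ * d₂) := by
            nlinarith
          have h5 : q₁ * q₁ ≤ 2 * (q₁ * (q₁ * d₁) * q₂) := by nlinarith
          have h6 : q₁ * (q₁ * d₁) * q₂ = q₁ * q₂ * (q₁ * d₁ - q₂ * d₂) + q₁ * q₂ * q₂ * d₂ := by
            ring
          have h7 : 2 * q₁ * (q₁ * d₁ - q₂ * d₂) * q₂ ≤ q₂ * (q₁ * d₁ - q₂ * d₂) * q₂ :=
            mul_le_mul_of_nonneg_right h4 hq₂0.le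
          have h8 : 0 ≤ q₁ * q₂ * q₂ * d₂ := by positivity
          have h9 : 0 ≤ (q₁ * d₁ - q₂ * d₂) * q₂ ^ 2 := by positivity
          nlinarith
        have h10 : 0 ≤ q₁ * d₁ - q₂ * d₂ + 2 * (q₁ * d₂) := by
          have := mul_pos hq₁0 hd₂
          linarith
        have h11 := mul_le_mul_of_nonneg_left h2 h10
        nlinarith
    nlinarith

theorem exists_odd_even_approximant {α : ℝ} (hirr : Irrational α) (h0 : 0 < α)
    (h1 : α < 1 / 2) {C : ℝ} (hC : 0 ≤ C) (N : ℕ) :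
    ∃ q p : ℤ, (N : ℤ) < q ∧ Even q ∧ Odd p ∧ (q : ℝ) * |q * α - p| ≤ 1 - C / (q : ℝ) ^ 2 := by
  obtain ⟨M, hM⟩ := exists_nat_ge (max (4 * C + 4) N + 1)
  have hMC : 4 * C + 4 ≤ M := by linarith [le_max_left (4 * C + 4) (N : ℝ)]
  have hMN : N < M := by
    have : (N : ℝ) < M := by linarith [le_max_right (4 * C + 4) (N : ℝ)]
    exact_mod_cast this
  obtain ⟨η, hη, hgap⟩ := hirr.exists_pos_le_abs_mul_sub M
  obtain ⟨n, hn⟩ := exists_nat_gt (max (2 / η) M)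
  obtain ⟨q₁, q₂, p₁, p₂, σ, hσ, hq1, hnq, hlt, hd2, hd1, hdet⟩ :=
    exists_consecutive_approximants hirr h0 h1 n
  set d₂ : ℝ := -(σ * (q₂ * α - p₂)) with hd₂
  set d₁ : ℝ := σ * (q₁ * α - p₁) with hd₁
  have hσ2 : (σ : ℝ) = 1 ∨ (σ : ℝ) = -1 := by
    rcases hσ with h | h <;> simp [h]
  have hdet' : q₁ * d₂ + q₂ * d₁ = 1 := by
    have : (σ : ℝ) * (q₁ * p₂ - q₂ * p₁) = 1 := by exact_mod_cast hdet
    rw [hd₁, hd₂]; linear_combination this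
  have habs : ∀ x : ℝ, |σ * x| = |x| := by
    intro x; rcases hσ2 with h | h <;> simp [h]
  have e₁ : |q₁ * α - p₁| = d₁ := by
    rw [← habs, ← hd₁, abs_of_pos (hd2.trans hd1)]
  have e₂ : |q₂ * α - p₂| = d₂ := by
    rw [← habs, ← abs_neg, ← hd₂, abs_of_pos hd2]
  have hnq' : (n : ℝ) ≤ q₁ := by exact_mod_cast hnq
  have hlt' : (q₁ : ℝ) + 1 ≤ q₂ := by exact_mod_cast hlt
  have hMq : (M : ℝ) < q₁ := by linarith [le_max_right (2 / η) (M : ℝ)]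
  have hMq' : (M : ℤ) < q₁ := by exact_mod_cast hMq
  have hq₁0 : (0 : ℝ) < q₁ := by linarith
  have hodd : Odd (q₁ * p₂ - q₂ * p₁) := by
    rcases hσ with h | h
    · rw [h] at hdet; exact ⟨0, by linarith⟩
    · rw [h] at hdet; exact ⟨-1, by linarith⟩
  rcases Int.even_or_odd q₁ with hev₁ | hod₁
  · refine ⟨q₁, p₁, by omega, hev₁, ?_, ?_⟩
    · by_contra hp
      rw [Int.not_odd_iff_even] at hp
      exact (Int.not_even_iff_odd.2 hodd) ((hev₁.mul_right _).sub (hp.mul_left _))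
    · rw [e₁, le_sub_iff_add_le, ← le_sub_iff_add_le', div_le_iff₀ (by positivity)]
      have h2 : d₁ ≤ 1 - q₁ * d₁ := by nlinarith
      have h3 : 1 ≤ (1 - q₁ * d₁) * (2 * q₁) := by nlinarith
      nlinarith
  rcases Int.even_or_odd q₂ with hev₂ | hod₂
  · refine ⟨q₂, p₂, by omega, hev₂, ?_, ?_⟩
    · by_contra hp
      rw [Int.not_odd_iff_even] at hp
      exact (Int.not_even_iff_odd.2 hodd) ((hp.mul_left _).sub (hev₂.mul_right _))
    · rw [e₂, le_sub_iff_add_le, ← le_sub_iff_add_le', div_le_iff₀ (by nlinarith)]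
      have h2 : d₂ ≤ 1 - q₂ * d₂ := by nlinarith
      have h3 : 1 ≤ (1 - q₂ * d₂) * (2 * q₂) := by nlinarith
      nlinarith
  · have hsum : Odd (p₁ + p₂) := by
      rw [Int.odd_sub, Int.odd_mul, Int.even_mul] at hodd
      rw [Int.odd_add]
      have a1 := Int.not_even_iff_odd.2 hod₂
      simp only [hod₁, a1, true_and, false_or] at hodd
      rcases Int.even_or_odd p₁ with h | h
      · have := hodd.2 h
        simp [Int.not_odd_iff_even.2 h, Int.not_even_iff_odd.2 this]
      · have : ¬ Odd p₂ := fun h' => (Int.not_even_iff_odd.2 h) (hodd.1 h')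
        simp [h, Int.not_odd_iff_even.1 this]
    have hdiff : Odd (p₂ - p₁) := by
      have : p₂ - p₁ = (p₁ + p₂) - 2 * p₁ := by ring
      rw [this]; exact hsum.sub_even (even_two_mul _)
    have e₃ : |((q₁ + q₂ : ℤ) : ℝ) * α - (p₁ + p₂ : ℤ)| = |d₁ - d₂| := by
      rw [← habs]; congr 1; rw [hd₁, hd₂]; push_cast; ring
    have e₄ : |((q₂ - q₁ : ℤ) : ℝ) * α - (p₂ - p₁ : ℤ)| = |d₁ + d₂| := by
      rw [← habs, ← abs_neg]; congr 1; rw [hd₁, hd₂]; push_cast; ring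
    have hr : (M : ℤ) < q₂ - q₁ := by
      by_contra! hcon
      have h2 := hgap (q₂ - q₁) (p₂ - p₁) (by omega) hcon
      rw [e₄, abs_of_pos (by linarith)] at h2
      have h3 : 2 / η < q₁ := by linarith [le_max_left (2 / η) (M : ℝ)]
      rw [div_lt_iff₀ hη] at h3
      nlinarith
    have hr' : (M : ℝ) < q₂ - q₁ := by exact_mod_cast hr
    rcases product_bound_of_basis hC hMC hMq.le (by linarith) hr'.le hd2 hd1 hdet' with h | h
    · refine ⟨q₁ + q₂, p₁ + p₂, by omega, hod₁.add_odd hod₂, hsum, ?_⟩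
      rw [e₃]; push_cast; exact h
    · refine ⟨q₂ - q₁, p₂ - p₁, by omega, hod₂.sub_odd hod₁, hdiff, ?_⟩
      rw [e₄]; push_cast; exact h

theorem intervalIntegrable_inv_sqrt_mul {g : ℝ → ℝ} (hg : ContinuousOn g (Icc 0 1))
    (hpos : ∀ t ∈ Icc (0 : ℝ) 1, 0 < g t) :
    IntervalIntegrable (fun t : ℝ => 1 / √((1 - t ^ 2) * g t)) MeasureTheory.volume 0 1 := by
  have h1 : IntervalIntegrable (fun t : ℝ => √(1 - t ^ 2)⁻¹) MeasureTheory.volume 0 1 :=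
    Polynomial.Chebyshev.intervalIntegrable_sqrt_one_sub_sq_inv.mono_set (by
      rw [uIcc_of_le (by norm_num), uIcc_of_le (by norm_num)]
      exact Icc_subset_Icc (by norm_num) le_rfl)
  have h2 : ContinuousOn (fun t => (√(g t))⁻¹) (uIcc 0 1) := by
    rw [uIcc_of_le zero_le_one]
    exact (hg.sqrt).inv₀ fun t ht => (Real.sqrt_pos.2 (hpos t ht)).ne'
  refine (h1.mul_continuousOn h2).congr fun t ht => ?_
  rw [uIoc_of_le zero_le_one] at ht
  have : 0 ≤ 1 - t ^ 2 := by nlinarith [ht.1, ht.2]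
  simp only [Real.sqrt_mul this, one_div, mul_inv, Real.sqrt_inv]

section Modulus

variable {k : ℝ}

theorem one_sub_sq_mul_sq_pos (hk : k ^ 2 < 1) {t : ℝ} (ht : t ∈ Icc (0 : ℝ) 1) :
    0 < 1 - k ^ 2 * t ^ 2 := by
  have : t ^ 2 ≤ 1 := by nlinarith [ht.1, ht.2]
  nlinarith [sq_nonneg t, sq_nonneg k]

theorem one_sub_sq_mul_one_sub_sq_pos (hk : k ^ 2 < 1) (t : ℝ) :
    0 < 1 - k ^ 2 * (1 - t ^ 2) := by
  nlinarith [mul_nonneg (sq_nonneg k) (sq_nonneg t)]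

theorem intervalIntegrable_Kell (hk : k ^ 2 < 1) :
    IntervalIntegrable (fun t : ℝ => 1 / √((1 - t ^ 2) * (1 - k ^ 2 * t ^ 2)))
      MeasureTheory.volume 0 1 :=
  intervalIntegrable_inv_sqrt_mul (by fun_prop) fun _ ht => one_sub_sq_mul_sq_pos hk ht

theorem intervalIntegrable_Hfun (hk : k ^ 2 < 1) :
    IntervalIntegrable (fun t : ℝ => 1 / √((1 - t ^ 2) * (1 - k ^ 2 * (1 - t ^ 2))))
      MeasureTheory.volume 0 1 :=
  intervalIntegrable_inv_sqrt_mul (by fun_prop) fun t _ => one_sub_sq_mul_one_sub_sq_pos hk t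

theorem Kell_pos (hk : k ^ 2 < 1) : 0 < Kell k := by
  refine intervalIntegral.intervalIntegral_pos_of_pos_on (intervalIntegrable_Kell hk) ?_ one_pos
  intro t ht
  have h1 := one_sub_sq_mul_sq_pos hk (Ioo_subset_Icc_self ht)
  have h2 : 0 < 1 - t ^ 2 := by nlinarith [ht.1, ht.2]
  positivity

/-- The substitution `t ↦ √(1 - t²)` in the complete elliptic integral. -/
theorem Kell_eq_integral (k : ℝ) :
    Kell k = ∫ t in (0 : ℝ)..1, 1 / √((1 - t ^ 2) * (1 - k ^ 2 * (1 - t ^ 2))) := by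
  have himg : (fun t : ℝ => √(1 - t ^ 2)) '' Ioo 0 1 = Ioo 0 1 := by
    have hmaps : ∀ t ∈ Ioo (0 : ℝ) 1, √(1 - t ^ 2) ∈ Ioo (0 : ℝ) 1 := fun t ht =>
      ⟨Real.sqrt_pos.2 (by nlinarith [ht.1, ht.2]),
        (Real.sqrt_lt' one_pos).2 (by nlinarith [ht.1, ht.2])⟩
    refine Subset.antisymm (image_subset_iff.2 hmaps) fun t ht => ⟨√(1 - t ^ 2), hmaps t ht, ?_⟩
    simp only
    rw [Real.sq_sqrt (by nlinarith [ht.1, ht.2]), sub_sub_cancel, Real.sqrt_sq ht.1.le]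
  have hinj : InjOn (fun t : ℝ => √(1 - t ^ 2)) (Ioo 0 1) := by
    intro s hs t ht h
    have h' := (Real.sqrt_inj (by nlinarith [hs.1, hs.2]) (by nlinarith [ht.1, ht.2])).1 h
    exact (pow_left_inj₀ hs.1.le ht.1.le two_ne_zero).1 (by linarith)
  have hder : ∀ t ∈ Ioo (0 : ℝ) 1, HasDerivWithinAt (fun t : ℝ => √(1 - t ^ 2))
      (-(t / √(1 - t ^ 2))) (Ioo 0 1) t := by
    intro t ht
    have h1 : 1 - t ^ 2 ≠ 0 := by nlinarith [ht.1, ht.2]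
    have h2 : HasDerivAt (fun t : ℝ => 1 - t ^ 2) (-(2 * t)) t := by
      simpa using (hasDerivAt_pow 2 t).const_sub 1
    have h3 := (h2.sqrt h1).hasDerivWithinAt (s := Ioo 0 1)
    rwa [neg_div, mul_div_mul_left _ _ two_ne_zero] at h3
  rw [Kell, intervalIntegral.integral_of_le zero_le_one, intervalIntegral.integral_of_le zero_le_one,
    MeasureTheory.integral_Ioc_eq_integral_Ioo, MeasureTheory.integral_Ioc_eq_integral_Ioo]
  conv_lhs => rw [← himg]
  rw [MeasureTheory.integral_image_eq_integral_abs_deriv_smul measurableSet_Ioo hder hinj]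
  refine MeasureTheory.setIntegral_congr_fun measurableSet_Ioo fun t ht => ?_
  have h1 : 0 < 1 - t ^ 2 := by nlinarith [ht.1, ht.2]
  have h2 := Real.sqrt_pos.2 h1
  simp only [smul_eq_mul]
  rw [Real.sq_sqrt h1.le, abs_neg, abs_of_pos (div_pos ht.1 h2), sub_sub_cancel,
    Real.sqrt_mul (sq_nonneg t), Real.sqrt_sq ht.1.le, Real.sqrt_mul h1.le]
  have := ht.1.ne'
  field_simp

theorem two_mul_sqrt_le_Kell_sub_Hfun (hk0 : 0 < k) (hk : k ^ 2 < 1) :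
    2 * √(2 * k ^ 2 - 1) ≤ Kell k - Hfun k := by
  set a := √((2 * k ^ 2 - 1) / k ^ 2) with ha
  have ha0 : 0 ≤ a := Real.sqrt_nonneg _
  have ha1 : a ≤ 1 := by
    rw [ha, Real.sqrt_le_one, div_le_one (by positivity)]
    linarith
  have hak : k * a = √(2 * k ^ 2 - 1) := by
    rw [ha, Real.sqrt_div' _ (sq_nonneg k), Real.sqrt_sq hk0.le]
    field_simp
  have hint := intervalIntegrable_Hfun hk
  have hi1 := hint.mono_set (c := 0) (d := a) (by
    rw [uIcc_of_le ha0, uIcc_of_le zero_le_one]; exact Icc_subset_Icc le_rfl ha1)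
  have hi2 := hint.mono_set (c := a) (d := 1) (by
    rw [uIcc_of_le ha1, uIcc_of_le zero_le_one]; exact Icc_subset_Icc ha0 le_rfl)
  have hsplit : Kell k - Hfun k =
      ∫ t in (0 : ℝ)..a, 1 / √((1 - t ^ 2) * (1 - k ^ 2 * (1 - t ^ 2))) := by
    rw [Kell_eq_integral, Hfun, ← intervalIntegral.integral_add_adjacent_intervals hi1 hi2,
      add_sub_cancel_right]
  have hconst : 2 * √(2 * k ^ 2 - 1) = ∫ _ in (0 : ℝ)..a, 2 * k := by
    rw [intervalIntegral.integral_const, smul_eq_mul, ← hak]; ring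
  rw [hsplit, hconst]
  refine intervalIntegral.integral_mono_on_of_le_Ioo ha0 (by simp) hi1 fun t ht => ?_
  have h1 : 0 < 1 - t ^ 2 := by nlinarith [ht.1, ht.2]
  have h2 := one_sub_sq_mul_one_sub_sq_pos hk t
  have h3 : 0 < √((1 - t ^ 2) * (1 - k ^ 2 * (1 - t ^ 2))) := Real.sqrt_pos.2 (mul_pos h1 h2)
  rw [le_div_iff₀ h3, ← le_div_iff₀' (by positivity)]
  refine Real.sqrt_le_iff.2 ⟨by positivity, ?_⟩
  rw [div_pow, le_div_iff₀ (by positivity)]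
  nlinarith [sq_nonneg (2 * k ^ 2 * (1 - t ^ 2) - 1)]

theorem Hfun_le (hk0 : 0 < k) (hk : k ^ 2 < 1) (hk2 : 1 < 2 * k ^ 2) {m : ℝ} (hm : m ^ 2 < 1) :
    Hfun k ≤ 2 * Kell m := by
  set a := √((2 * k ^ 2 - 1) / k ^ 2) with ha
  have ha0 : 0 ≤ a := Real.sqrt_nonneg _
  have ha2 : k ^ 2 * a ^ 2 = 2 * k ^ 2 - 1 := by
    rw [ha, Real.sq_sqrt (div_nonneg (by linarith) (sq_nonneg k))]
    field_simp
  have ha1 : a ≤ 1 := by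
    rw [ha, Real.sqrt_le_one, div_le_one (by positivity)]
    linarith
  have hint := (intervalIntegrable_Kell hm).const_mul 2
  have hi1 := hint.mono_set (c := 0) (d := a) (by
    rw [uIcc_of_le ha0, uIcc_of_le zero_le_one]; exact Icc_subset_Icc le_rfl ha1)
  have hi2 := hint.mono_set (c := a) (d := 1) (by
    rw [uIcc_of_le ha1, uIcc_of_le zero_le_one]; exact Icc_subset_Icc ha0 le_rfl)
  have hiH := (intervalIntegrable_Hfun hk).mono_set (c := a) (d := 1) (by
    rw [uIcc_of_le ha1, uIcc_of_le zero_le_one]; exact Icc_subset_Icc ha0 le_rfl)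
  rw [Kell, ← intervalIntegral.integral_const_mul,
    ← intervalIntegral.integral_add_adjacent_intervals hi1 hi2]
  refine le_add_of_nonneg_of_le
    (intervalIntegral.integral_nonneg ha0 fun t _ => by positivity) ?_
  refine intervalIntegral.integral_mono_on_of_le_Ioo ha1 hiH hi2 fun t ht => ?_
  have ht0 : 0 < t := ha0.trans_lt ht.1
  have h1 : 0 < 1 - t ^ 2 := by nlinarith [ht.2]
  have h2 := one_sub_sq_mul_one_sub_sq_pos hk t
  have h3 := one_sub_sq_mul_sq_pos hm ⟨ht0.le, ht.2.le⟩
  have h4 : a ^ 2 ≤ t ^ 2 := by nlinarith [ht.1]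
  have h5 : 1 - m ^ 2 * t ^ 2 ≤ 4 * (1 - k ^ 2 * (1 - t ^ 2)) := by
    nlinarith [mul_le_mul_of_nonneg_left h4 (sq_nonneg k), mul_nonneg (sq_nonneg m) (sq_nonneg t)]
  have h6 : √((1 - t ^ 2) * (1 - m ^ 2 * t ^ 2)) ≤
      2 * √((1 - t ^ 2) * (1 - k ^ 2 * (1 - t ^ 2))) := by
    refine Real.sqrt_le_iff.2 ⟨by positivity, ?_⟩
    rw [mul_pow, Real.sq_sqrt (by positivity)]
    nlinarith
  have h7 : 0 < √((1 - t ^ 2) * (1 - m ^ 2 * t ^ 2)) := Real.sqrt_pos.2 (mul_pos h1 h3)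
  have h8 : 0 < √((1 - t ^ 2) * (1 - k ^ 2 * (1 - t ^ 2))) := Real.sqrt_pos.2 (mul_pos h1 h2)
  rw [mul_one_div, div_le_div_iff₀ h8 h7]
  linarith

theorem Kell_sq_le (hk : k ^ 2 ≤ 3 / 4) (hk2 : 1 < 2 * k ^ 2) {m : ℝ} (hm : m ^ 2 = 1 / 2) :
    Kell k ^ 2 ≤ (1 + 2 * (2 * k ^ 2 - 1)) * Kell m ^ 2 := by
  set c := 1 + 2 * (2 * k ^ 2 - 1) with hc
  have hc0 : 0 ≤ c := by linarith
  have hk1 : k ^ 2 < 1 := by linarith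
  have hm1 : m ^ 2 < 1 := by linarith
  have hle : Kell k ≤ √c * Kell m := by
    rw [Kell, Kell, ← intervalIntegral.integral_const_mul]
    refine intervalIntegral.integral_mono_on_of_le_Ioo zero_le_one (intervalIntegrable_Kell hk1)
      ((intervalIntegrable_Kell hm1).const_mul _) fun t ht => ?_
    have h1 : 0 < 1 - t ^ 2 := by nlinarith [ht.1, ht.2]
    have h2 := one_sub_sq_mul_sq_pos hk1 (Ioo_subset_Icc_self ht)
    have h3 := one_sub_sq_mul_sq_pos hm1 (Ioo_subset_Icc_self ht)
    have h7 : 0 < √((1 - t ^ 2) * (1 - m ^ 2 * t ^ 2)) := Real.sqrt_pos.2 (mul_pos h1 h3)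
    have h8 : 0 < √((1 - t ^ 2) * (1 - k ^ 2 * t ^ 2)) := Real.sqrt_pos.2 (mul_pos h1 h2)
    rw [mul_one_div, div_le_div_iff₀ h8 h7, one_mul, ← Real.sqrt_mul hc0]
    refine Real.sqrt_le_sqrt ?_
    have h9 : 1 - m ^ 2 * t ^ 2 ≤ c * (1 - k ^ 2 * t ^ 2) := by
      have h10 : k ^ 2 * t ^ 2 ≤ 3 / 4 * 1 := by
        apply mul_le_mul hk (by linarith) (sq_nonneg t) (by norm_num)
      have h11 : t ^ 2 ≤ 1 := by linarith
      rw [hm, hc]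
      nlinarith [mul_nonneg (by linarith : 0 ≤ 2 * k ^ 2 - 1) (by linarith : 0 ≤ 3 / 4 - k ^ 2 * t ^ 2),
        mul_nonneg (by linarith : 0 ≤ 2 * k ^ 2 - 1) h1.le]
    nlinarith
  calc Kell k ^ 2 ≤ (√c * Kell m) ^ 2 := pow_le_pow_left₀ (Kell_pos hk1).le hle 2
    _ = c * Kell m ^ 2 := by rw [mul_pow, Real.sq_sqrt hc0]

theorem Sfun_le (hk0 : 0 < k) (hk : k ^ 2 < 1) :
    Sfun k ≤ 2 * (1 - phiFun k) * Kell k ^ 2 := by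
  have hK := Kell_pos hk
  have h := two_mul_sqrt_le_Kell_sub_Hfun hk0 hk
  have e : 2 * (1 - phiFun k) * Kell k ^ 2 = 2 * (Kell k - Hfun k) * Kell k := by
    rw [phiFun]; field_simp
  rw [e, Sfun]
  nlinarith

theorem sqrt_le_one_sub_phiFun_mul (hk0 : 0 < k) (hk : k ^ 2 < 1) (hk2 : 1 < 2 * k ^ 2) {m : ℝ}
    (hm : m ^ 2 < 1) : √(2 * k ^ 2 - 1) ≤ (1 - phiFun k) * (Kell m + 1) := by
  have hK := Kell_pos hk
  have hKm := Kell_pos hm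
  have h := two_mul_sqrt_le_Kell_sub_Hfun hk0 hk
  have hH := Hfun_le hk0 hk hk2 hm
  have hs0 := Real.sqrt_nonneg (2 * k ^ 2 - 1)
  have hs1 : √(2 * k ^ 2 - 1) ≤ 1 := Real.sqrt_le_one.2 (by linarith)
  rw [phiFun, one_sub_div hK.ne', div_mul_eq_mul_div, le_div_iff₀ hK]
  nlinarith

end Modulus

theorem one_sub_xiSeq_le (α : ℝ) {n : ℕ} {p : ℤ} (hp : Odd p) :
    1 - xiSeq α n ≤ |2 * n * α - p| := by
  obtain ⟨m, rfl⟩ := hp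
  rw [xiSeq]
  set f := ⌊α * n + 1 / 2⌋
  have h : (1 : ℝ) ≤ |2 * (f : ℝ) - (2 * m + 1)| := by
    have : (1 : ℤ) ≤ |2 * f - (2 * m + 1)| := Int.one_le_abs (by omega)
    exact_mod_cast this
  have e : 2 * |α * n - f| = |2 * n * α - 2 * f| := by
    rw [← abs_two, ← abs_mul, abs_two]; congr 1; ring
  have h3 := abs_sub_le (2 * (f : ℝ)) (2 * n * α) (2 * m + 1)
  rw [abs_sub_comm (2 * (f : ℝ)) (2 * n * α)] at h3
  rw [e]; push_cast
  linarith

theorem mul_Sfun_le {k n m x P : ℝ} (hk0 : 0 < k) (hk : k ^ 2 < 1) (hk2 : 1 < 2 * k ^ 2)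
    (hm : m ^ 2 = 1 / 2) (hn : 0 < n) (hnK : Kell m + 1 ≤ n)
    (hx : 1 - phiFun k ≤ x) (hP : 2 * n * x ≤ P)
    (hPC : P ≤ 1 - 2 * (Kell m + 1) ^ 2 / (2 * n) ^ 2) :
    n * Sfun k ≤ Kell m ^ 2 := by
  have hm1 : m ^ 2 < 1 := by linarith
  have hKm := Kell_pos hm1
  set c := (Kell m + 1) ^ 2 / (2 * n) ^ 2 with hc
  have hc0 : 0 ≤ c := by positivity
  have hPc : P ≤ 1 - 2 * c := by rw [hc, ← mul_div_assoc]; exact hPC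
  have hphi : 2 * n * (1 - phiFun k) ≤ 1 - 2 * c :=
    (mul_le_mul_of_nonneg_left hx (by positivity)).trans (hP.trans hPc)
  have hs := sqrt_le_one_sub_phiFun_mul hk0 hk hk2 hm1
  have hs0 := Real.sqrt_nonneg (2 * k ^ 2 - 1)
  have hs1 : √(2 * k ^ 2 - 1) ≤ (Kell m + 1) / (2 * n) := by
    rw [le_div_iff₀ (by positivity)]
    have : 2 * n * (1 - phiFun k) * (Kell m + 1) ≤ 1 * (Kell m + 1) :=
      mul_le_mul_of_nonneg_right (by linarith) (by positivity)
    nlinarith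
  have hs2 : 2 * k ^ 2 - 1 ≤ c := by
    rw [← Real.sq_sqrt (by linarith : 0 ≤ 2 * k ^ 2 - 1), hc, ← div_pow]
    exact pow_le_pow_left₀ hs0 hs1 2
  have hc4 : c ≤ 1 / 4 := by
    rw [hc, div_le_iff₀ (by positivity)]; nlinarith
  have hKK := Kell_sq_le (by linarith) hk2 hm
  have hS := Sfun_le hk0 hk
  calc n * Sfun k ≤ n * (2 * (1 - phiFun k) * Kell k ^ 2) := mul_le_mul_of_nonneg_left hS hn.le
    _ = 2 * n * (1 - phiFun k) * Kell k ^ 2 := by ring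
    _ ≤ (1 - 2 * c) * Kell k ^ 2 := mul_le_mul_of_nonneg_right hphi (sq_nonneg _)
    _ ≤ (1 - 2 * c) * ((1 + 2 * c) * Kell m ^ 2) := by
        refine mul_le_mul_of_nonneg_left (hKK.trans ?_) (by linarith)
        exact mul_le_mul_of_nonneg_right (by linarith) (sq_nonneg _)
    _ ≤ Kell m ^ 2 := by nlinarith [mul_nonneg (sq_nonneg c) (sq_nonneg (Kell m))]

/-- infinitely many indices n satisfy 0 ≤ √(−ω_n) ≤ K(1/√2)²/L. -/
theorem stmt_14 (L₁ L α : ℝ) (hL₁ : 0 < L₁) (hL : L₁ ≤ L / 2)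
    (hα : α = L₁ / L) (hirr : Irrational α)
    (ω : ℕ → ℝ) (hω : ∀ n : ℕ, 1 ≤ n → ω n < 0)
    (hk : ∀ n : ℕ, 1 ≤ n → ∃ k ∈ Set.Ioo (1 / Real.sqrt 2) 1,
      Sfun k = L * Real.sqrt (-(ω n)) / n ∧ phiFun k = xiSeq α n) :
    {n : ℕ | 1 ≤ n ∧ 0 ≤ Real.sqrt (-(ω n)) ∧
      Real.sqrt (-(ω n)) ≤ (1 / L) * Kell (1 / Real.sqrt 2) ^ 2}.Infinite := by
  have hL0 : 0 < L := by linarith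
  have hα0 : 0 < α := hα ▸ div_pos hL₁ hL0
  have hα1 : α < 1 / 2 := by
    refine lt_of_le_of_ne (by rw [hα, div_le_iff₀ hL0]; linarith) fun h => ?_
    exact hirr ⟨1 / 2, by rw [h]; norm_num⟩
  set m : ℝ := 1 / √2 with hm
  have hm0 : 0 < m := by positivity
  have hm2 : m ^ 2 = 1 / 2 := by rw [hm, div_pow, Real.sq_sqrt two_pos.le, one_pow]
  obtain ⟨M, hM⟩ := exists_nat_ge (Kell m + 1)
  refine Set.infinite_of_forall_exists_gt fun N => ?_
  obtain ⟨q, p, hq, ⟨j, hj⟩, hp, hqp⟩ := exists_odd_even_approximant hirr hα0 hα1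
    (C := 2 * (Kell m + 1) ^ 2) (by positivity) (2 * (N + M))
  obtain ⟨n, rfl⟩ : ∃ n : ℕ, j = n := ⟨j.toNat, by omega⟩
  have hn1 : 1 ≤ n := by omega
  have hn0 : (0 : ℝ) < n := by exact_mod_cast hn1
  have hqn : (q : ℝ) = 2 * n := by rw [hj]; push_cast; ring
  rw [hqn] at hqp
  obtain ⟨k, ⟨hmk, hk1⟩, hS, hphi⟩ := hk n hn1
  have hk0 : 0 < k := hm0.trans hmk
  have hMn : (M : ℝ) ≤ n := by
    have : M ≤ n := by omega
    exact_mod_cast this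
  have key := mul_Sfun_le hk0 (by nlinarith) (by nlinarith) hm2 hn0 (hM.trans hMn)
    (hphi ▸ one_sub_xiSeq_le α hp) le_rfl hqp
  refine ⟨n, ⟨hn1, Real.sqrt_nonneg _, ?_⟩, by omega⟩
  rw [hS, mul_div_cancel₀ _ hn0.ne'] at key
  rwa [one_div, inv_mul_eq_div, le_div_iff₀' hL0]
end

section
/- Let L > 0 be a real number. For every ω₀ ≤ 0 there exist an irrational number α ∈ (0, 1), a sequence (ω_n)_{n≥1} of negative reals such that for every n ≥ 1 there exists k ∈ (1/√2, 1) with S(k) = L·√(−ω_n)/n and φ(k) = ξ_n (where ξ_n = 2|αn − ⌊αn + 1/2⌋|), and a strictly increasing sequence of positive integers (n_j) such that ω_{n_j} → ω₀ as j → ∞. -/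
open Real Filter Set

open MeasureTheory Topology Interval

/-- The two-parameter integral `∫₀¹ dt / √((1 - a t²)(1 - b t²))`. -/
noncomputable def ellInt (a b : ℝ) : ℝ :=
  ∫ t in (0:ℝ)..1, 1 / √((1 - a * t ^ 2) * (1 - b * t ^ 2))

lemma intervalIntegrable_one_div_sqrt_one_sub_sq_mul (β : ℝ) :
    IntervalIntegrable (fun t : ℝ => 1 / √((1 - t ^ 2) * (1 - β))) volume 0 1 := by
  have h : IntervalIntegrable (fun t : ℝ => 1 / √(1 - t ^ 2)) volume 0 1 := by
    apply intervalIntegral.intervalIntegrable_deriv_of_nonneg (g := arcsin)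
    · exact continuous_arcsin.continuousOn
    · intro x hx
      simp only [zero_le_one, inf_of_le_left, sup_of_le_right, mem_Ioo] at hx
      exact hasDerivAt_arcsin (by linarith) (by linarith)
    · intro x _
      positivity
  have h' : (fun t : ℝ => 1 / √((1 - t ^ 2) * (1 - β))) =ᵐ[volume.restrict (Ι 0 1)]
      fun t => 1 / √(1 - β) * (1 / √(1 - t ^ 2)) := by
    filter_upwards [ae_restrict_mem measurableSet_uIoc] with t ht
    rw [uIoc_of_le zero_le_one] at ht
    rw [sqrt_mul (by nlinarith [ht.1, ht.2]), one_div_mul_one_div, mul_comm]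
  exact (h.const_mul _).congr_ae h'.symm

lemma one_sub_mul_sq_pos {a t : ℝ} (ha : a ≤ 1) (ht : t ∈ Ioo (0:ℝ) 1) : 0 < 1 - a * t ^ 2 := by
  nlinarith [ht.1, ht.2, mul_le_mul_of_nonneg_right ha (sq_nonneg t)]

lemma ellInt_integrand_mono {a a' b b' t : ℝ} (ha : a ≤ a') (ha' : a' ≤ 1) (hb : b ≤ b')
    (hb' : b' ≤ 1) (ht : t ∈ Ioo (0:ℝ) 1) :
    1 / √((1 - a * t ^ 2) * (1 - b * t ^ 2)) ≤ 1 / √((1 - a' * t ^ 2) * (1 - b' * t ^ 2)) := by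
  have h1 := one_sub_mul_sq_pos ha' ht
  have h2 := one_sub_mul_sq_pos hb' ht
  have h3 := one_sub_mul_sq_pos (ha.trans ha') ht
  apply one_div_le_one_div_of_le (by positivity)
  apply sqrt_le_sqrt
  gcongr

lemma ellInt_integrand_le {a b β t : ℝ} (ha : a ≤ 1) (hb : b ≤ β) (hβ₀ : 0 ≤ β) (hβ : β < 1)
    (ht : t ∈ Ioo (0:ℝ) 1) :
    1 / √((1 - a * t ^ 2) * (1 - b * t ^ 2)) ≤ 1 / √((1 - t ^ 2) * (1 - β)) := by
  have h1 := one_sub_mul_sq_pos le_rfl ht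
  have h2 := one_sub_mul_sq_pos ha ht
  rw [one_mul] at h1
  have h3 : 0 < 1 - β := by linarith
  apply one_div_le_one_div_of_le (by positivity)
  apply sqrt_le_sqrt
  apply mul_le_mul _ _ h3.le h2.le
  · nlinarith [sq_nonneg t]
  · nlinarith [sq_nonneg t, mul_le_mul_of_nonneg_right hb (sq_nonneg t)]

lemma ae_mem_uIoc_imp_of_forall_Ioo {p : ℝ → Prop} (h : ∀ t ∈ Ioo (0:ℝ) 1, p t) :
    ∀ᵐ t, t ∈ Ι (0:ℝ) 1 → p t := by
  filter_upwards [compl_mem_ae_iff.mpr (measure_singleton (1:ℝ))] with t ht ht'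
  rw [uIoc_of_le zero_le_one] at ht'
  exact h t ⟨ht'.1, lt_of_le_of_ne ht'.2 ht⟩

lemma aestronglyMeasurable_ellInt_integrand (a b : ℝ) (μ : Measure ℝ) :
    AEStronglyMeasurable (fun t : ℝ => 1 / √((1 - a * t ^ 2) * (1 - b * t ^ 2))) μ :=
  Measurable.aestronglyMeasurable (by fun_prop)

lemma intervalIntegrable_ellInt {a b : ℝ} (ha : a ≤ 1) (hb : b < 1) :
    IntervalIntegrable (fun t : ℝ => 1 / √((1 - a * t ^ 2) * (1 - b * t ^ 2))) volume 0 1 := by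
  refine (intervalIntegrable_one_div_sqrt_one_sub_sq_mul (max b 0)).mono_fun
    (aestronglyMeasurable_ellInt_integrand a b _) ?_
  refine (ae_restrict_iff' measurableSet_uIoc).2 (ae_mem_uIoc_imp_of_forall_Ioo fun t ht => ?_)
  beta_reduce
  rw [norm_of_nonneg (by positivity), norm_of_nonneg (by positivity)]
  exact ellInt_integrand_le ha (le_max_left _ _) (le_max_right _ _) (max_lt hb one_pos) ht

lemma ellInt_mono {a a' b b' : ℝ} (ha : a ≤ a') (ha' : a' ≤ 1) (hb : b ≤ b') (hb' : b' < 1) :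
    ellInt a b ≤ ellInt a' b' :=
  intervalIntegral.integral_mono_on_of_le_Ioo zero_le_one
    (intervalIntegrable_ellInt (ha.trans ha') (hb.trans_lt hb')) (intervalIntegrable_ellInt ha' hb')
    fun _ ht => ellInt_integrand_mono ha ha' hb hb'.le ht

lemma one_le_ellInt {a b : ℝ} (ha₀ : 0 ≤ a) (ha : a ≤ 1) (hb₀ : 0 ≤ b) (hb : b < 1) :
    1 ≤ ellInt a b := by
  refine le_trans (by simp [ellInt]) (ellInt_mono ha₀ ha hb₀ hb)

lemma continuousWithinAt_ellInt {a b : ℝ} (ha : a ≤ 1) (hb : b < 1) :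
    ContinuousWithinAt (fun p : ℝ × ℝ => ellInt p.1 p.2) (Iic 1 ×ˢ Iio 1) (a, b) := by
  obtain ⟨β, hβ, hβ₁⟩ := exists_between (max_lt hb one_pos)
  have hnear : ∀ᶠ p : ℝ × ℝ in 𝓝[Iic 1 ×ˢ Iio 1] (a, b), p.1 ≤ 1 ∧ p.2 < β := by
    refine eventually_mem_nhdsWithin.and (nhdsWithin_le_nhds ?_) |>.mono fun p hp => ⟨hp.1.1, hp.2⟩
    exact continuous_snd.continuousAt.eventually_lt continuousAt_const
      ((le_max_left _ _).trans_lt hβ)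
  refine intervalIntegral.continuousWithinAt_of_dominated_interval
    (bound := fun t => 1 / √((1 - t ^ 2) * (1 - β)))
    (Eventually.of_forall fun p => aestronglyMeasurable_ellInt_integrand _ _ _) ?_
    (intervalIntegrable_one_div_sqrt_one_sub_sq_mul β) ?_
  · filter_upwards [hnear] with p hp
    refine ae_mem_uIoc_imp_of_forall_Ioo fun t ht => ?_
    rw [norm_of_nonneg (by positivity)]
    exact ellInt_integrand_le hp.1 hp.2.le ((le_max_right _ _).trans hβ.le) hβ₁ ht
  · refine ae_mem_uIoc_imp_of_forall_Ioo fun t ht => ContinuousAt.continuousWithinAt ?_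
    have h1 := one_sub_mul_sq_pos ha ht
    have h2 := one_sub_mul_sq_pos hb.le ht
    refine ContinuousAt.div continuousAt_const (by fun_prop) ?_
    simp only
    positivity

lemma Kell_eq (k : ℝ) : Kell k = ellInt 1 (k ^ 2) := by simp [Kell, ellInt]

lemma two_mul_sq_ge {k : ℝ} (hk : 1 / √2 ≤ k) : 1 ≤ 2 * k ^ 2 := by
  have h : (1 / √2) ^ 2 ≤ k ^ 2 := by gcongr
  rw [div_pow, sq_sqrt (by norm_num)] at h
  linarith

lemma pos_of_one_div_sqrt_two_le {k : ℝ} (hk : 1 / √2 ≤ k) : 0 < k :=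
  lt_of_lt_of_le (by positivity) hk

lemma sq_lt_one_of_mem_Ico {k : ℝ} (hk : k ∈ Ico (1 / √2) 1) : k ^ 2 < 1 := by
  nlinarith [hk.2, pos_of_one_div_sqrt_two_le hk.1]

lemma one_div_sq_sub_one_mem {k : ℝ} (hk : k ∈ Ico (1 / √2) 1) : 1 / k ^ 2 - 1 ∈ Ioc (0:ℝ) 1 := by
  have hk0 := pos_of_one_div_sqrt_two_le hk.1
  have hk1 := sq_lt_one_of_mem_Ico hk
  have hk2 := two_mul_sq_ge hk.1
  constructor
  · rw [sub_pos, lt_div_iff₀ (by positivity)]; linarith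
  · rw [sub_le_iff_le_add, div_le_iff₀ (by positivity)]; linarith

lemma Hfun_eq {k : ℝ} (hk : k ∈ Ico (1 / √2) 1) :
    Hfun k = √(1 / k ^ 2 - 1) * ellInt (1 / k ^ 2 - 1) (1 - k ^ 2) := by
  have hk0 := pos_of_one_div_sqrt_two_le hk.1
  have hk2 := two_mul_sq_ge hk.1
  have hk1 := sq_lt_one_of_mem_Ico hk
  obtain ⟨hq0, hq1⟩ := one_div_sq_sub_one_mem hk
  set q := 1 / k ^ 2 - 1 with hq
  have hkq : k ^ 2 * q = 1 - k ^ 2 := by rw [hq]; field_simp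
  have hlow : (2 * k ^ 2 - 1) / k ^ 2 = 1 - q := by rw [hq]; field_simp; ring
  have himg : (fun v : ℝ => √(1 - q * v ^ 2)) '' Ioo 0 1 = Ioo (√(1 - q)) 1 := by
    ext t
    constructor
    · rintro ⟨v, hv, rfl⟩
      have hv2 : 0 < v ^ 2 := by have := hv.1; positivity
      have hv1 : v ^ 2 < 1 := by nlinarith [hv.1, hv.2]
      refine ⟨sqrt_lt_sqrt (by linarith) (by nlinarith), ?_⟩
      rw [sqrt_lt' one_pos]
      nlinarith
    · intro ht
      have ht0 : 0 ≤ t := (sqrt_nonneg _).trans ht.1.le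
      have ht1 := (sqrt_lt' (lt_of_le_of_lt (sqrt_nonneg _) ht.1)).1 ht.1
      have ht2 : t ^ 2 < 1 := by nlinarith [ht.2]
      refine ⟨√((1 - t ^ 2) / q), ⟨sqrt_pos.2 (div_pos (by linarith) hq0), ?_⟩, ?_⟩
      · rw [sqrt_lt' one_pos, div_lt_iff₀ hq0]; linarith
      · simp only
        rw [sq_sqrt (div_nonneg (by linarith) hq0.le), mul_div_cancel₀ _ hq0.ne', sub_sub_cancel,
          sqrt_sq ht0]
  have hinj : InjOn (fun v : ℝ => √(1 - q * v ^ 2)) (Ioo 0 1) := by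
    intro v hv w hw h
    have h' := (sqrt_inj (one_sub_mul_sq_pos hq1 hv).le (one_sub_mul_sq_pos hq1 hw).le).1 h
    have h'' : v ^ 2 = w ^ 2 := mul_left_cancel₀ hq0.ne' (by linarith)
    exact (pow_left_inj₀ hv.1.le hw.1.le two_ne_zero).1 h''
  have hder : ∀ v ∈ Ioo (0:ℝ) 1, HasDerivWithinAt (fun v : ℝ => √(1 - q * v ^ 2))
      (-(q * (2 * v)) / (2 * √(1 - q * v ^ 2))) (Ioo 0 1) v := by
    intro v hv
    have h : HasDerivAt (fun v : ℝ => 1 - q * v ^ 2) (-(q * (2 * v))) v := by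
      simpa using ((hasDerivAt_pow 2 v).const_mul q).const_sub 1
    exact (h.sqrt (one_sub_mul_sq_pos hq1 hv).ne').hasDerivWithinAt
  have hle : √(1 - q) ≤ 1 := by exact (sqrt_le_sqrt (by linarith)).trans_eq sqrt_one
  rw [Hfun, hlow, intervalIntegral.integral_of_le hle, integral_Ioc_eq_integral_Ioo, ← himg,
    integral_image_eq_integral_abs_deriv_smul measurableSet_Ioo hder hinj, ellInt,
    ← intervalIntegral.integral_const_mul, intervalIntegral.integral_of_le zero_le_one,
    integral_Ioc_eq_integral_Ioo]
  refine setIntegral_congr_fun measurableSet_Ioo fun v hv => ?_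
  have hA := one_sub_mul_sq_pos hq1 hv
  have hB := one_sub_mul_sq_pos (a := 1 - k ^ 2) (by nlinarith) hv
  have hv0 := hv.1
  simp only [smul_eq_mul]
  rw [sq_sqrt hA.le, sub_sub_cancel, ← mul_assoc (k ^ 2), hkq, abs_div, abs_neg,
    abs_of_pos (by positivity : 0 < q * (2 * v)), abs_of_pos (by positivity),
    sqrt_mul (by positivity), sqrt_mul hA.le, sqrt_mul hq0.le, sqrt_sq hv0.le]
  have h1 := sqrt_pos.2 hA
  have h2 := sqrt_pos.2 hB
  have h3 := sqrt_pos.2 hq0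
  field_simp
  rw [sq_sqrt hq0.le]

lemma one_div_sqrt_two_sq : (1 / √2 : ℝ) ^ 2 = 1 / 2 := by
  rw [div_pow, sq_sqrt (by norm_num), one_pow]

lemma one_div_sqrt_two_lt_one : 1 / √2 < 1 := by
  rw [div_lt_one (by positivity), lt_sqrt (by norm_num)]
  norm_num

lemma one_le_Kell {k : ℝ} (hk : k ∈ Ico (1 / √2) 1) : 1 ≤ Kell k := by
  rw [Kell_eq]
  exact one_le_ellInt zero_le_one le_rfl (sq_nonneg k) (sq_lt_one_of_mem_Ico hk)

lemma Kell_monotoneOn : MonotoneOn Kell (Ico (1 / √2) 1) := by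
  intro k hk l hl hkl
  have hk0 := pos_of_one_div_sqrt_two_le hk.1
  rw [Kell_eq, Kell_eq]
  exact ellInt_mono le_rfl le_rfl (by gcongr) (sq_lt_one_of_mem_Ico hl)

lemma Kell_continuousOn : ContinuousOn Kell (Ico (1 / √2) 1) := by
  intro k hk
  have h := continuousWithinAt_ellInt le_rfl (sq_lt_one_of_mem_Ico hk)
  have hm : MapsTo (fun k : ℝ => ((1:ℝ), k ^ 2)) (Ico (1 / √2) 1) (Iic 1 ×ˢ Iio 1) :=
    fun l hl => ⟨le_refl (1:ℝ), sq_lt_one_of_mem_Ico hl⟩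
  refine (h.comp (f := fun k : ℝ => ((1:ℝ), k ^ 2)) (by fun_prop) hm).congr
    (fun l _ => Kell_eq l) (Kell_eq k)

lemma Hfun_pos {k : ℝ} (hk : k ∈ Ico (1 / √2) 1) : 0 < Hfun k := by
  have hq := one_div_sq_sub_one_mem hk
  have hk1 := sq_lt_one_of_mem_Ico hk
  have hk2 := two_mul_sq_ge hk.1
  have h := one_le_ellInt hq.1.le hq.2 (b := 1 - k ^ 2) (by linarith) (by linarith)
  rw [Hfun_eq hk]
  exact mul_pos (sqrt_pos.2 hq.1) (by linarith)

lemma Hfun_strictAntiOn : StrictAntiOn Hfun (Ico (1 / √2) 1) := by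
  intro k hk l hl hkl
  have hk0 := pos_of_one_div_sqrt_two_le hk.1
  have hqk := one_div_sq_sub_one_mem hk
  have hql := one_div_sq_sub_one_mem hl
  have hl1 := sq_lt_one_of_mem_Ico hl
  have hk2 := two_mul_sq_ge hk.1
  have hsq : k ^ 2 < l ^ 2 := by gcongr
  have hq : 1 / l ^ 2 - 1 < 1 / k ^ 2 - 1 := by gcongr
  rw [Hfun_eq hk, Hfun_eq hl]
  refine mul_lt_mul (sqrt_lt_sqrt hql.1.le hq)
    (ellInt_mono hq.le hqk.2 (by linarith) (by linarith)) ?_ (sqrt_nonneg _)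
  exact one_pos.trans_le (one_le_ellInt hql.1.le hql.2 (by linarith) (by nlinarith))

lemma Hfun_continuousOn : ContinuousOn Hfun (Ico (1 / √2) 1) := by
  have hne : ∀ k ∈ Ico (1 / √2) 1, k ^ 2 ≠ 0 := fun k hk =>
    pow_ne_zero 2 (pos_of_one_div_sqrt_two_le hk.1).ne'
  have hc : ContinuousOn (fun k : ℝ => 1 / k ^ 2 - 1) (Ico (1 / √2) 1) :=
    (continuousOn_const.div (by fun_prop) hne).sub continuousOn_const
  refine (hc.sqrt.mul (g := fun k => ellInt (1 / k ^ 2 - 1) (1 - k ^ 2)) ?_).congr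
    fun k hk => Hfun_eq hk
  intro k hk
  have hm : MapsTo (fun k : ℝ => (1 / k ^ 2 - 1, 1 - k ^ 2)) (Ico (1 / √2) 1)
      (Iic 1 ×ˢ Iio 1) := fun l hl =>
    ⟨(one_div_sq_sub_one_mem hl).2, sub_lt_self _ (pow_pos (pos_of_one_div_sqrt_two_le hl.1) 2)⟩
  exact (continuousWithinAt_ellInt (hm hk).1 (hm hk).2).comp
    (f := fun k : ℝ => (1 / k ^ 2 - 1, 1 - k ^ 2))
    ((hc k hk).prodMk (by fun_prop)) hm

lemma phiFun_strictAntiOn : StrictAntiOn phiFun (Ico (1 / √2) 1) := by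
  intro k hk l hl hkl
  exact div_lt_div₀ (Hfun_strictAntiOn hk hl hkl) (Kell_monotoneOn hk hl hkl.le)
    (Hfun_pos hk).le (one_pos.trans_le (one_le_Kell hk))

lemma phiFun_continuousOn : ContinuousOn phiFun (Ico (1 / √2) 1) :=
  Hfun_continuousOn.div Kell_continuousOn fun _ hk => (one_pos.trans_le (one_le_Kell hk)).ne'

lemma left_mem : 1 / √2 ∈ Ico (1 / √2 : ℝ) 1 := ⟨le_rfl, one_div_sqrt_two_lt_one⟩

lemma phiFun_one_div_sqrt_two : phiFun (1 / √2) = 1 := by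
  have h : Hfun (1 / √2) = Kell (1 / √2) := by
    rw [Hfun_eq left_mem, Kell_eq, one_div_sqrt_two_sq]
    norm_num
  rw [phiFun, h, div_self (one_pos.trans_le (one_le_Kell left_mem)).ne']

lemma phiFun_pos {k : ℝ} (hk : k ∈ Ico (1 / √2) 1) : 0 < phiFun k :=
  div_pos (Hfun_pos hk) (one_pos.trans_le (one_le_Kell hk))

lemma phiFun_le {k : ℝ} (hk : k ∈ Ico (1 / √2) 1) :
    phiFun k ≤ √(1 / k ^ 2 - 1) * ellInt 1 (1 / 2) := by
  have hq := one_div_sq_sub_one_mem hk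
  have hk2 := two_mul_sq_ge hk.1
  refine (div_le_self (Hfun_pos hk).le (one_le_Kell hk)).trans ?_
  rw [Hfun_eq hk]
  gcongr
  exact ellInt_mono hq.2 le_rfl (by linarith) (by norm_num)

lemma exists_phiFun_lt {x : ℝ} (hx : 0 < x) : ∃ k ∈ Ico (1 / √2) 1, phiFun k < x := by
  have hc : ContinuousAt (fun k : ℝ => √(1 / k ^ 2 - 1) * ellInt 1 (1 / 2)) 1 := by
    refine ContinuousAt.mul (ContinuousAt.sqrt ?_) continuousAt_const
    exact (continuousAt_const.div (by fun_prop) (by norm_num)).sub continuousAt_const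
  have h1 : ∀ᶠ k in 𝓝[<] (1:ℝ), √(1 / k ^ 2 - 1) * ellInt 1 (1 / 2) < x :=
    nhdsWithin_le_nhds (hc.eventually_lt continuousAt_const (by simpa using hx))
  have h2 : ∀ᶠ k in 𝓝[<] (1:ℝ), k ∈ Ico (1 / √2) 1 :=
    Ico_mem_nhdsLT one_div_sqrt_two_lt_one
  obtain ⟨k, hk, hk'⟩ := (h1.and h2).exists
  exact ⟨k, hk', (phiFun_le hk').trans_lt hk⟩

lemma exists_phiFun_eq {x : ℝ} (hx : x ∈ Ioo (0:ℝ) 1) : ∃ k ∈ Ioo (1 / √2) 1, phiFun k = x := by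
  obtain ⟨l, hl, hlx⟩ := exists_phiFun_lt hx.1
  have hsub : Icc (1 / √2) l ⊆ Ico (1 / √2) 1 := Icc_subset_Ico_right hl.2
  obtain ⟨k, hk, hkx⟩ := intermediate_value_Ioo' hl.1 (phiFun_continuousOn.mono hsub)
    ⟨hlx, by rw [phiFun_one_div_sqrt_two]; exact hx.2⟩
  exact ⟨k, ⟨hk.1, hk.2.trans hl.2⟩, hkx⟩

lemma Sfun_strictMonoOn : StrictMonoOn Sfun (Ico (1 / √2) 1) := by
  intro k hk l hl hkl
  have hk0 := pos_of_one_div_sqrt_two_le hk.1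
  have hk2 := two_mul_sq_ge hk.1
  have hsq : k ^ 2 < l ^ 2 := by gcongr
  unfold Sfun
  refine mul_lt_mul ?_ (Kell_monotoneOn hk hl hkl.le) (one_pos.trans_le (one_le_Kell hk))
    (by positivity)
  have := sqrt_lt_sqrt (by linarith) (by linarith : 2 * k ^ 2 - 1 < 2 * l ^ 2 - 1)
  linarith

lemma Sfun_continuousOn : ContinuousOn Sfun (Ico (1 / √2) 1) :=
  ContinuousOn.mul (by fun_prop) Kell_continuousOn

lemma Sfun_one_div_sqrt_two : Sfun (1 / √2) = 0 := by
  rw [Sfun, one_div_sqrt_two_sq]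
  norm_num

lemma exists_Sfun_eq {k c : ℝ} (hk : k ∈ Ico (1 / √2) 1) (hc₀ : 0 ≤ c) (hc : c ≤ Sfun k) :
    ∃ l ∈ Ico (1 / √2) 1, Sfun l = c := by
  have hsub : Icc (1 / √2) k ⊆ Ico (1 / √2) 1 := Icc_subset_Ico_right hk.2
  obtain ⟨l, hl, hlc⟩ := intermediate_value_Icc hk.1 (Sfun_continuousOn.mono hsub)
    ⟨by rwa [Sfun_one_div_sqrt_two], hc⟩
  exact ⟨l, hsub hl, hlc⟩

lemma xiSeq_eq {α x : ℝ} {n : ℕ} {m : ℤ} (hx : x ∈ Ico (0:ℝ) 1) (h : α * n = m + x / 2) :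
    xiSeq α n = x := by
  have hf : ⌊α * n + 1 / 2⌋ = m := by
    rw [Int.floor_eq_iff, h]
    constructor <;> linarith [hx.1, hx.2]
  rw [xiSeq, hf, h, add_sub_cancel_left, abs_of_nonneg (by linarith [hx.1])]
  ring

lemma xiSeq_mem_Ioo {α : ℝ} (hα : Irrational α) {n : ℕ} (hn : 1 ≤ n) :
    xiSeq α n ∈ Ioo (0:ℝ) 1 := by
  have hn0 : n ≠ 0 := by omega
  have hirr : Irrational (α * n) := hα.mul_natCast hn0
  have h1 := Int.floor_le (α * n + 1 / 2)
  have h2 := Int.lt_floor_add_one (α * n + 1 / 2)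
  set m := ⌊α * n + 1 / 2⌋ with hm
  have h0 : α * n - m ≠ 0 := fun h => hirr.ne_int m (by linarith)
  have h3 : α * n - m ≠ -(1 / 2) := fun h => by
    refine hirr.ne_rat (m - 1 / 2) ?_
    push_cast
    linarith
  have h4 : -(1 / 2) < α * n - m := lt_of_le_of_ne (by linarith) h3.symm
  have h5 : |α * n - m| < 1 / 2 := abs_lt.2 ⟨h4, by linarith⟩
  rw [xiSeq, ← hm]
  exact ⟨by have := abs_pos.2 h0; linarith, by linarith⟩

/-- The set of `α` for which some index beyond `N` has scaled period `n S(k)` in `(c, c + δ)`. -/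
def goodSet (c δ : ℝ) (N : ℕ) : Set ℝ :=
  {α | ∃ n > N, ∃ k ∈ Ioo (1 / √2) 1, phiFun k = xiSeq α n ∧ n * Sfun k ∈ Ioo c (c + δ)}

lemma dense_interior_goodSet {c δ : ℝ} (hc : 0 ≤ c) (hδ : 0 < δ) (N : ℕ) :
    Dense (interior (goodSet c δ N)) := by
  rw [Metric.dense_iff]
  intro α r hr
  obtain ⟨k₀, hk₀⟩ := exists_between one_div_sqrt_two_lt_one
  have hk₀' : k₀ ∈ Ico (1 / √2) 1 := ⟨hk₀.1.le, hk₀.2⟩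
  have hS₀ : 0 < Sfun k₀ := by
    rw [← Sfun_one_div_sqrt_two]; exact Sfun_strictMonoOn left_mem hk₀' hk₀.1
  obtain ⟨n, hn⟩ := exists_nat_gt (max (N:ℝ) (max ((c + δ) / Sfun k₀) (1 / r)))
  simp only [max_lt_iff] at hn
  obtain ⟨hnN, hnS, hnr⟩ := hn
  have hn0 : (0:ℝ) < n := (Nat.cast_nonneg N).trans_lt hnN
  rw [div_lt_iff₀ hS₀] at hnS
  rw [div_lt_iff₀ hr] at hnr
  have hup : (c + δ) / n ≤ Sfun k₀ := by rw [div_le_iff₀ hn0]; linarith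
  have hlt : c / n < (c + δ) / n := by gcongr; linarith
  obtain ⟨k₁, hk₁, hS₁⟩ := exists_Sfun_eq hk₀' (by positivity) (hlt.le.trans hup)
  obtain ⟨k₂, hk₂, hS₂⟩ := exists_Sfun_eq hk₀' (by positivity) hup
  have hk₁₂ : k₁ < k₂ := (Sfun_strictMonoOn.lt_iff_lt hk₁ hk₂).1 (by rwa [hS₁, hS₂])
  have hφ := phiFun_strictAntiOn hk₁ hk₂ hk₁₂
  have hφ₂ := phiFun_pos hk₂
  have hφ₁ : phiFun k₁ ≤ 1 := by
    rw [← phiFun_one_div_sqrt_two]; exact phiFun_strictAntiOn.antitoneOn left_mem hk₁ hk₁.1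
  set m := ⌊α * n⌋ with hm
  have hm₁ : (m:ℝ) ≤ α * n := Int.floor_le _
  have hm₂ : α * n < m + 1 := Int.lt_floor_add_one _
  have hsub : Ioo ((m + phiFun k₂ / 2) / n) ((m + phiFun k₁ / 2) / n) ⊆ goodSet c δ N := by
    rintro β ⟨hβ₁, hβ₂⟩
    rw [div_lt_iff₀ hn0] at hβ₁
    rw [lt_div_iff₀ hn0] at hβ₂
    have hsub' : Icc k₁ k₂ ⊆ Ico (1 / √2) 1 := fun x hx => ⟨hk₁.1.trans hx.1, hx.2.trans_lt hk₂.2⟩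
    obtain ⟨k, hk, hkφ⟩ : 2 * (β * n - m) ∈ phiFun '' Ioo k₁ k₂ :=
      intermediate_value_Ioo' hk₁₂.le (phiFun_continuousOn.mono hsub')
        ⟨by linarith, by linarith⟩
    have hkJ := hsub' (Ioo_subset_Icc_self hk)
    refine ⟨n, by exact_mod_cast hnN, k, ⟨hk₁.1.trans_lt hk.1, hkJ.2⟩, ?_, ?_⟩
    · rw [hkφ]
      exact (xiSeq_eq (m := m) ⟨by linarith, by linarith⟩ (by ring)).symm
    · have h1 := Sfun_strictMonoOn hk₁ hkJ hk.1
      have h2 := Sfun_strictMonoOn hkJ hk₂ hk.2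
      rw [hS₁, div_lt_iff₀ hn0] at h1
      rw [hS₂, lt_div_iff₀ hn0] at h2
      exact ⟨by linarith, by linarith⟩
  obtain ⟨β, hβ⟩ : (Ioo ((m + phiFun k₂ / 2) / n) ((m + phiFun k₁ / 2) / n)).Nonempty := by
    refine nonempty_Ioo.2 ?_
    gcongr
  refine ⟨β, ?_, interior_maximal hsub isOpen_Ioo hβ⟩
  have hβ₁ := hβ.1
  have hβ₂ := hβ.2
  rw [div_lt_iff₀ hn0] at hβ₁
  rw [lt_div_iff₀ hn0] at hβ₂
  rw [Metric.mem_ball, Real.dist_eq, abs_lt]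
  constructor <;> by_contra! h <;>
    nlinarith [mul_le_mul_of_nonneg_right h hn0.le]

lemma exists_irrational_mem_goodSet {c : ℝ} (hc : 0 ≤ c) :
    ∃ α ∈ Ioo (0:ℝ) 1, Irrational α ∧ ∀ N : ℕ, α ∈ goodSet c (1 / (N + 1)) N := by
  have h : ∀ᶠ α in residual ℝ, Irrational α ∧ ∀ N : ℕ, α ∈ goodSet c (1 / (N + 1)) N := by
    refine eventually_residual_irrational.and (eventually_countable_forall.2 fun N => ?_)
    exact mem_of_superset (residual_of_dense_open isOpen_interior
      (dense_interior_goodSet hc (by positivity) N)) interior_subset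
  obtain ⟨α, hα, hα'⟩ := (dense_of_mem_residual h).exists_mem_open isOpen_Ioo
    (nonempty_Ioo.2 (zero_lt_one (α := ℝ)))
  exact ⟨α, hα', hα⟩

/-- for every ω₀ ≤ 0 there is an irrational α ∈ (0,1) and a sequence
of admitted frequencies (ω_n) with a subsequence converging to ω₀. -/
theorem stmt_17 (L : ℝ) (hL : 0 < L) (ω₀ : ℝ) (hω₀ : ω₀ ≤ 0) :
    ∃ α : ℝ, α ∈ Set.Ioo (0:ℝ) 1 ∧ Irrational α ∧
    ∃ ω : ℕ → ℝ, (∀ n : ℕ, 1 ≤ n → ω n < 0) ∧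
      (∀ n : ℕ, 1 ≤ n → ∃ k ∈ Set.Ioo (1 / Real.sqrt 2) 1,
        Sfun k = L * Real.sqrt (-(ω n)) / n ∧ phiFun k = xiSeq α n) ∧
      ∃ g : ℕ → ℕ, StrictMono g ∧ (∀ j, 1 ≤ g j) ∧
        Filter.Tendsto (fun j => ω (g j)) Filter.atTop (nhds ω₀) := by
  set c := L * √(-ω₀) with hc
  obtain ⟨α, hα, hirr, hgood⟩ := exists_irrational_mem_goodSet (c := c) (by positivity)
  refine ⟨α, hα, hirr, ?_⟩
  have hex : ∀ n : ℕ, ∃ k, 1 ≤ n → k ∈ Ioo (1 / √2) 1 ∧ phiFun k = xiSeq α n := fun n => by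
    by_cases hn : 1 ≤ n
    · obtain ⟨k, hk, hkx⟩ := exists_phiFun_eq (xiSeq_mem_Ioo hirr hn)
      exact ⟨k, fun _ => ⟨hk, hkx⟩⟩
    · exact ⟨0, fun h => absurd h hn⟩
  choose κ hκ using hex
  have hS : ∀ n : ℕ, 1 ≤ n → 0 < Sfun (κ n) := fun n hn => by
    rw [← Sfun_one_div_sqrt_two]
    exact Sfun_strictMonoOn left_mem (Ioo_subset_Ico_self (hκ n hn).1) (hκ n hn).1.1
  have hfreq : ∀ N : ℕ, ∃ᶠ n : ℕ in atTop,
      1 ≤ n ∧ n * Sfun (κ n) ∈ Ioo c (c + 1 / ((N:ℝ) + 1)) := fun N => by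
    rw [frequently_atTop]
    intro a
    obtain ⟨n, hn, k, hk, hkx, hkS⟩ := hgood (max a N)
    have hn1 : 1 ≤ n := by omega
    have hkκ : k = κ n := phiFun_strictAntiOn.injOn (Ioo_subset_Ico_self hk)
      (Ioo_subset_Ico_self (hκ n hn1).1) (hkx.trans (hκ n hn1).2.symm)
    refine ⟨n, by omega, hn1, hkκ ▸ hkS.1, hkκ ▸ hkS.2.trans_le ?_⟩
    gcongr
    exact le_max_right _ _
  obtain ⟨g, hg, hg'⟩ := extraction_forall_of_frequently hfreq
  refine ⟨fun n => -(n * Sfun (κ n) / L) ^ 2, fun n hn => ?_, fun n hn => ?_, g, hg,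
    fun j => (hg' j).1, ?_⟩
  · have hn0 : (0:ℝ) < n := by exact_mod_cast hn
    have := hS n hn
    simp only [Left.neg_neg_iff]
    positivity
  · have hn0 : (0:ℝ) < n := by exact_mod_cast hn
    have := hS n hn
    refine ⟨κ n, (hκ n hn).1, ?_, (hκ n hn).2⟩
    rw [neg_neg, sqrt_sq (by positivity)]
    field_simp
  · have hlim : Tendsto (fun j => (g j : ℝ) * Sfun (κ (g j))) atTop (𝓝 c) := by
      refine tendsto_of_tendsto_of_tendsto_of_le_of_le tendsto_const_nhds ?_
        (fun j => (hg' j).2.1.le) (fun j => (hg' j).2.2.le)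
      simpa using tendsto_one_div_add_atTop_nhds_zero_nat.const_add c
    have hval : -(c / L) ^ 2 = ω₀ := by
      rw [hc, mul_div_cancel_left₀ _ hL.ne', sq_sqrt (by linarith), neg_neg]
    rw [← hval]
    exact ((hlim.div_const L).pow 2).neg
end

section
/- For every real number ℓ ≥ 0 there exist a real number α ∈ (0, 1) and a strictly increasing sequence of positive integers (n_j)_{j≥1} such that n_j·({n_j·α} − 1/2) → ℓ as j → ∞, where {x} = x − ⌊x⌋ denotes the fractional part. -/
open Real Filter Set

/-- The set of `α` for which `n * (n * α - m - 1/2)` is within `1 / (k + 1)` of `ℓ` for some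
integer `m` and some `n ≥ k` exceeding `2 * (ℓ + 1)`. -/
def halfApproxSet (ℓ : ℝ) (k : ℕ) : Set ℝ :=
  {α | ∃ n : ℕ, ∃ m : ℤ, k ≤ n ∧ 2 * (ℓ + 1) < n ∧
    |(n : ℝ) * (n * α - m - 1 / 2) - ℓ| < 1 / ((k : ℝ) + 1)}

theorem isOpen_halfApproxSet (ℓ : ℝ) (k : ℕ) : IsOpen (halfApproxSet ℓ k) := by
  simp only [halfApproxSet, ofPred_exists, ofPred_and]
  refine isOpen_iUnion fun n => isOpen_iUnion fun m => ?_
  exact isOpen_const.inter (isOpen_const.inter (isOpen_lt (by fun_prop) continuous_const))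

theorem dense_halfApproxSet {ℓ : ℝ} (hℓ : 0 ≤ ℓ) (k : ℕ) : Dense (halfApproxSet ℓ k) := by
  rw [Metric.dense_iff]
  intro x ε hε
  obtain ⟨n, hn⟩ := exists_nat_gt (max (max (k : ℝ) (2 * (ℓ + 1))) (1 / ε))
  obtain ⟨hn', hnε⟩ := max_lt_iff.1 hn
  obtain ⟨hnk, hnℓ⟩ := max_lt_iff.1 hn'
  have hn0 : (0 : ℝ) < n := by linarith
  set y : ℝ := n * x - 1 / 2 - ℓ / n with hy
  refine ⟨(⌊y⌋ + 1 / 2 + ℓ / n) / n, ?_, n, ⌊y⌋, by exact_mod_cast hnk.le, hnℓ, ?_⟩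
  · have hdiff : (⌊y⌋ + 1 / 2 + ℓ / n) / n - x = -(Int.fract y / n) := by
      rw [← Int.self_sub_floor, hy]
      field_simp
      ring
    rw [Metric.mem_ball, Real.dist_eq, hdiff, abs_neg,
      abs_of_nonneg (div_nonneg (Int.fract_nonneg y) hn0.le)]
    calc Int.fract y / n ≤ 1 / n := by gcongr; exact (Int.fract_lt_one y).le
      _ < ε := (one_div_lt hε hn0).1 hnε
  · have hzero : (n : ℝ) * (n * ((⌊y⌋ + 1 / 2 + ℓ / n) / n) - ⌊y⌋ - 1 / 2) - ℓ = 0 := by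
      field_simp
      ring
    rw [hzero, abs_zero]
    positivity

theorem exists_fract_of_mem_halfApproxSet {ℓ α : ℝ} (hℓ : 0 ≤ ℓ) {k : ℕ}
    (hα : α ∈ halfApproxSet ℓ k) :
    ∃ n : ℕ, k ≤ n ∧ 1 ≤ n ∧
      |(n : ℝ) * (Int.fract ((n : ℝ) * α) - 1 / 2) - ℓ| < 1 / ((k : ℝ) + 1) := by
  obtain ⟨n, m, hkn, hn, h⟩ := hα
  have hn0 : (0 : ℝ) < n := by linarith
  have hk : 1 / ((k : ℝ) + 1) ≤ 1 := by
    rw [div_le_one (by positivity)]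
    linarith [(k.cast_nonneg : (0 : ℝ) ≤ k)]
  obtain ⟨h₁, h₂⟩ := abs_lt.1 h
  have hfloor : ⌊(n : ℝ) * α⌋ = m := by
    rw [Int.floor_eq_iff]
    constructor <;> nlinarith
  refine ⟨n, hkn, by exact_mod_cast hn0, ?_⟩
  rwa [← Int.self_sub_floor, hfloor]

/-- for every ℓ ≥ 0 there exist α ∈ (0,1) and a strictly increasing
sequence of positive integers (n_j) with n_j·({n_j α} − 1/2) → ℓ. -/
theorem stmt_18 (ℓ : ℝ) (hℓ : 0 ≤ ℓ) :
    ∃ α : ℝ, α ∈ Set.Ioo (0:ℝ) 1 ∧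
    ∃ g : ℕ → ℕ, StrictMono g ∧ (∀ j, 1 ≤ g j) ∧
      Filter.Tendsto (fun j => (g j : ℝ) * (Int.fract ((g j : ℝ) * α) - 1/2))
        Filter.atTop (nhds ℓ) := by
  obtain ⟨α, hα, hαU⟩ := (dense_iInter_of_isOpen_nat (isOpen_halfApproxSet ℓ)
    (dense_halfApproxSet hℓ)).exists_mem_open isOpen_Ioo (nonempty_Ioo.2 (zero_lt_one' ℝ))
  have hfreq (j : ℕ) : ∃ᶠ n : ℕ in atTop, 1 ≤ n ∧
      |(n : ℝ) * (Int.fract ((n : ℝ) * α) - 1 / 2) - ℓ| < 1 / ((j : ℝ) + 1) := by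
    refine frequently_atTop.2 fun N => ?_
    obtain ⟨n, hn, hn1, h⟩ :=
      exists_fract_of_mem_halfApproxSet hℓ (mem_iInter.1 hα (max N j))
    refine ⟨n, (le_max_left N j).trans hn, hn1, h.trans_le ?_⟩
    gcongr
    exact le_max_right N j
  obtain ⟨g, hg, hgj⟩ := extraction_forall_of_frequently hfreq
  refine ⟨α, hαU, g, hg, fun j => (hgj j).1, tendsto_iff_dist_tendsto_zero.2 ?_⟩
  refine squeeze_zero (fun _ => dist_nonneg) (fun j => ?_)
    (tendsto_one_div_add_atTop_nhds_zero_nat (𝕜 := ℝ))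
  rw [Real.dist_eq]
  exact (hgj j).2.le
end

section
/- Let L₁, L be real numbers with 0 < L₁ ≤ L/2. (i) If L₁/L is irrational, then there is no μ > 0 with sin(μL₁) = 0 and cos(μL) = 1. (ii) If L₁/L = p₀/(2q₀) for coprime positive integers p₀, q₀, then the set {μ > 0 : sin(μL₁) = 0 and cos(μL) = 1} equals {2πq₀n/L : n a positive integer}. -/
open Real Filter Set

/-- Integer form of the eigenvalue condition on `μ`. -/
lemma sin_eq_zero_and_cos_eq_one_iff (x y : ℝ) :
    Real.sin x = 0 ∧ Real.cos y = 1 ↔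
      ∃ k m : ℤ, x = k * Real.pi ∧ y = m * (2 * Real.pi) := by
  rw [Real.sin_eq_zero_iff, Real.cos_eq_one_iff]
  constructor
  · rintro ⟨⟨k, hk⟩, m, hm⟩
    exact ⟨k, m, hk.symm, hm.symm⟩
  · rintro ⟨k, m, hk, hm⟩
    exact ⟨⟨k, hk.symm⟩, m, hm.symm⟩

/-- (i) if L₁/L is irrational there is no μ > 0 with sin(μL₁) = 0 and
cos(μL) = 1; (ii) if L₁/L = p₀/(2q₀) with p₀, q₀ coprime positive integers, the set
of such μ is {2πq₀n/L : n ≥ 1}. -/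
theorem stmt_19 (L₁ L : ℝ) (hL₁ : 0 < L₁) (hL : L₁ ≤ L / 2) :
    (Irrational (L₁ / L) →
      ¬∃ μ : ℝ, 0 < μ ∧ Real.sin (μ * L₁) = 0 ∧ Real.cos (μ * L) = 1) ∧
    (∀ p₀ q₀ : ℕ, 0 < p₀ → 0 < q₀ → Nat.Coprime p₀ q₀ →
      L₁ / L = (p₀ : ℝ) / (2 * q₀) →
      {μ : ℝ | 0 < μ ∧ Real.sin (μ * L₁) = 0 ∧ Real.cos (μ * L) = 1}
        = {μ : ℝ | ∃ n : ℕ, 1 ≤ n ∧ μ = 2 * Real.pi * q₀ * n / L}) := by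
  have hL₀ : 0 < L := by linarith
  have hpi := Real.pi_pos
  have ratio {μ : ℝ} (hμ : 0 < μ) {k m : ℤ} (hk : μ * L₁ = k * Real.pi)
      (hm : μ * L = m * (2 * Real.pi)) : L₁ / L = k / (2 * m) := by
    rw [← mul_div_mul_left L₁ L hμ.ne', hk, hm, ← mul_div_mul_right (k : ℝ) (2 * m) hpi.ne']
    ring
  refine ⟨?_, fun p₀ q₀ _ hq₀ hcop hratio => ?_⟩
  · rintro hirr ⟨μ, hμ, hsincos⟩
    obtain ⟨k, m, hk, hm⟩ := (sin_eq_zero_and_cos_eq_one_iff _ _).1 hsincos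
    refine hirr ⟨(k : ℚ) / (2 * m), ?_⟩
    push_cast
    exact (ratio hμ hk hm).symm
  have hq : (0 : ℝ) < q₀ := by exact_mod_cast hq₀
  ext μ
  simp only [mem_ofPred_eq, sin_eq_zero_and_cos_eq_one_iff]
  constructor
  · rintro ⟨hμ, k, m, hk, hm⟩
    have hm₀ : (0 : ℝ) < m := by
      have : 0 < (m : ℝ) * (2 * Real.pi) := hm ▸ mul_pos hμ hL₀
      exact pos_of_mul_pos_left this (by positivity)
    have hkm : (k : ℝ) * q₀ = p₀ * m := by
      have h := (ratio hμ hk hm).symm.trans hratio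
      field_simp at h
      linarith
    have hkm' : k * q₀ = p₀ * m := by exact_mod_cast hkm
    have hdvd : (q₀ : ℤ) ∣ m :=
      IsCoprime.dvd_of_dvd_mul_left (Nat.isCoprime_iff_coprime.2 hcop.symm)
        (Dvd.intro_left k hkm')
    obtain ⟨n, rfl⟩ := hdvd
    have hn : 0 < n := by
      push_cast at hm₀
      exact_mod_cast pos_of_mul_pos_right hm₀ hq.le
    lift n to ℕ using hn.le
    refine ⟨n, by exact_mod_cast hn, ?_⟩
    rw [eq_div_iff hL₀.ne', hm]
    push_cast
    ring
  · rintro ⟨n, hn, rfl⟩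
    have hn₀ : (0 : ℝ) < n := by exact_mod_cast hn
    refine ⟨by positivity, n * p₀, q₀ * n, ?_, ?_⟩
    · rw [div_mul_eq_mul_div, mul_div_assoc, hratio]
      push_cast
      field_simp
    · push_cast
      field_simp
end
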